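/- arXiv:1809.04917 — 2 statements merged into one kernel-verified Lean document; each statement's English description precedes it below -/
import Mathlib

section
/- If f, g : ℝ → [0, ∞) are log-concave and integrable (with respect to Lebesgue measure), then their convolution (f ∗ g)(x) = ∫_ℝ f(s) g(x − s) ds is log-concave. -/
open MeasureTheory

/-- A function `f : ℝ → [0, ∞)` is log-concave if
`f (λx + (1 − λ)y) ≥ f x ^ λ * f y ^ (1 − λ)` for all `x, y ∈ ℝ` and `λ ∈ [0, 1]`,
where `^` denotes the real power. -/
def LogConcave (f : ℝ → ℝ) : Prop :=
  ∀ x y l : ℝ, 0 ≤ l → l ≤ 1 →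
    f x ^ l * f y ^ (1 - l) ≤ f (l * x + (1 - l) * y)

lemma lt_geom_mean_aux {t u v m : ℝ} (ht : 0 ≤ t) (hu : t < u) (hv : t < v) (hm : 0 ≤ m) (hm1 : m ≤ 1) :
    t < u ^ m * v ^ (1 - m) := by
  have hw : t < min u v := lt_min hu hv
  have hw0 : 0 < min u v := lt_of_le_of_lt ht hw
  calc t < min u v := hw
    _ = (min u v) ^ m * (min u v) ^ (1 - m) := by
        rw [← Real.rpow_add hw0]; simp
    _ ≤ u ^ m * v ^ (1 - m) := by
        apply mul_le_mul
        · exact Real.rpow_le_rpow hw0.le (min_le_left _ _) hm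
        · exact Real.rpow_le_rpow hw0.le (min_le_right _ _) (by linarith)
        · positivity
        · exact Real.rpow_nonneg (ht.trans hu.le) _

lemma LogConcave.ordConnected {h : ℝ → ℝ} (hh : LogConcave h) {t : ℝ} (ht : 0 ≤ t) :
    Set.OrdConnected {x | t < h x} := by
  apply Convex.ordConnected
  intro a ha b hb m n hm hn hmn
  obtain rfl : n = 1 - m := by linarith
  have h1 := hh a b m hm (by linarith)
  have h2 := lt_geom_mean_aux ht ha hb hm (by linarith)
  simp only [Set.mem_ofPred_eq, smul_eq_mul]
  exact lt_of_lt_of_le h2 h1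

lemma LogConcave.bounded {f : ℝ → ℝ} (hf : LogConcave f) (hf0 : ∀ x, 0 ≤ f x)
    (hfi : Integrable f) : ∃ M, ∀ x, f x ≤ M := by
  by_cases hpq : ∃ p q, p < q ∧ 0 < f p ∧ 0 < f q
  · obtain ⟨p, q, hlt, hp, hq⟩ := hpq
    set m := min (f p) (f q) with hm
    have hm0 : 0 < m := lt_min hp hq
    set δ := (q - p) / 4 with hδ
    have hδ0 : 0 < δ := by rw [hδ]; linarith
    have hI : 0 ≤ ∫ x, f x := integral_nonneg hf0
    set T := (∫ x, f x) / δ + 1 with hT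
    have hT0 : 0 < T := by positivity
    refine ⟨max T (T ^ 2 / m), fun z => ?_⟩
    by_contra! hz
    have hz1 : T < f z := (le_max_left _ _).trans_lt hz
    have hz2 : T ^ 2 < f z * m := by
      rw [← div_lt_iff₀ hm0]; exact (le_max_right _ _).trans_lt hz
    obtain ⟨w, hw, hwz⟩ : ∃ w, m ≤ f w ∧ 2 * δ ≤ |w - z| := by
      rcases le_total z ((p + q) / 2) with h | h
      · exact ⟨q, min_le_right _ _, (by rw [hδ]; linarith : 2 * δ ≤ q - z).trans (le_abs_self _)⟩
      · exact ⟨p, min_le_left _ _, (by rw [hδ]; linarith : 2 * δ ≤ -(p - z)).trans (neg_le_abs _)⟩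
    have hc := hf z w (1/2) (by norm_num) (by norm_num)
    set c := 1/2 * z + (1 - 1/2) * w with hcdef
    have hc1 : T < f c := by
      refine lt_of_lt_of_le ?_ hc
      rw [show (1 - 1/2 : ℝ) = 1/2 by norm_num, ← Real.mul_rpow (hf0 _) (hf0 _), ← Real.sqrt_eq_rpow]
      apply Real.lt_sqrt_of_sq_lt
      exact hz2.trans_le (mul_le_mul_of_nonneg_left hw (hf0 _))
    have hsub : Set.uIcc z c ⊆ {x | T ≤ f x} := by
      intro x hx
      have h3 : T < f x := (hf.ordConnected hT0.le).uIcc_subset hz1 hc1 hx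
      exact h3.le
    have hmk := mul_meas_ge_le_integral_of_nonneg (μ := volume) (Filter.Eventually.of_forall hf0) hfi T
    have hmono : volume.real (Set.uIcc z c) ≤ volume.real {x | T ≤ f x} :=
      measureReal_mono hsub (hfi.measure_ge_lt_top hT0).ne
    have hlen : δ ≤ volume.real (Set.uIcc z c) := by
      rw [measureReal_def, Real.volume_interval, ENNReal.toReal_ofReal (abs_nonneg _)]
      have : c - z = (w - z) / 2 := by rw [hcdef]; ring
      rw [this, abs_div, abs_two]; linarith
    have : T * δ ≤ ∫ x, f x := (mul_le_mul_of_nonneg_left (hlen.trans hmono) hT0.le).trans hmk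
    have h2 : T * δ = (∫ x, f x) + δ := by rw [hT]; field_simp
    linarith
  · push Not at hpq
    by_cases hp : ∃ p, 0 < f p
    · obtain ⟨p, hp⟩ := hp
      refine ⟨f p, fun x => ?_⟩
      rcases lt_trichotomy x p with h | h | h
      · by_contra! hx
        linarith [hpq x p h (hp.trans hx)]
      · rw [h]
      · linarith [hpq p x h hp]
    · push Not at hp
      exact ⟨0, hp⟩

lemma bm {A B C : Set ℝ} {l : ℝ} (hl : 0 ≤ l) (hl1 : l ≤ 1) (hA : A.Nonempty) (hB : B.Nonempty)
    (hC : C.OrdConnected) (h : ∀ a ∈ A, ∀ b ∈ B, l * a + (1 - l) * b ∈ C) :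
    ENNReal.ofReal l * volume A + ENNReal.ofReal (1 - l) * volume B ≤ volume C := by
  have key : ∀ a ∈ A, ∀ a' ∈ A, ∀ b ∈ B, ∀ b' ∈ B,
      ENNReal.ofReal l * edist a a' + ENNReal.ofReal (1 - l) * edist b b' ≤ volume C := by
    have key0 : ∀ a ∈ A, ∀ a' ∈ A, ∀ b ∈ B, ∀ b' ∈ B, a ≤ a' → b ≤ b' →
      ENNReal.ofReal l * edist a a' + ENNReal.ofReal (1 - l) * edist b b' ≤ volume C := by
      intro a ha a' ha' b hb b' hb' h1 h2
      have hs := hC.out (h a ha b hb) (h a' ha' b' hb')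
      refine le_trans (le_of_eq ?_) (measure_mono hs)
      rw [Real.volume_Icc, edist_comm a, edist_comm b, edist_dist, edist_dist, Real.dist_eq,
        Real.dist_eq, abs_of_nonneg (by linarith), abs_of_nonneg (by linarith),
        ← ENNReal.ofReal_mul hl, ← ENNReal.ofReal_mul (by linarith), ← ENNReal.ofReal_add]
      · congr 1; ring
      · exact mul_nonneg hl (by linarith)
      · exact mul_nonneg (by linarith) (by linarith)
    intro a ha a' ha' b hb b' hb'
    rcases le_total a a' with h1 | h1 <;> rcases le_total b b' with h2 | h2
    · exact key0 a ha a' ha' b hb b' hb' h1 h2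
    · rw [edist_comm b]; exact key0 a ha a' ha' b' hb' b hb h1 h2
    · rw [edist_comm a]; exact key0 a' ha' a ha b hb b' hb' h1 h2
    · rw [edist_comm a, edist_comm b]; exact key0 a' ha' a ha b' hb' b hb h1 h2
  have : Nonempty A := hA.to_subtype
  have : Nonempty B := hB.to_subtype
  calc _ ≤ ENNReal.ofReal l * (⨆ p : A × A, edist (p.1 : ℝ) p.2)
        + ENNReal.ofReal (1 - l) * (⨆ p : B × B, edist (p.1 : ℝ) p.2) := by
        gcongr
        · refine (Real.volume_le_diam A).trans (Metric.ediam_le fun x hx y hy => ?_)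
          exact le_iSup (fun p : A × A => edist (p.1 : ℝ) p.2) (⟨x, hx⟩, ⟨y, hy⟩)
        · refine (Real.volume_le_diam B).trans (Metric.ediam_le fun x hx y hy => ?_)
          exact le_iSup (fun p : B × B => edist (p.1 : ℝ) p.2) (⟨x, hx⟩, ⟨y, hy⟩)
    _ ≤ volume C := by
        rw [ENNReal.mul_iSup, ENNReal.mul_iSup]
        apply ENNReal.iSup_add_iSup_le
        intro p q
        exact key _ p.1.2 _ p.2.2 _ q.1.2 _ q.2.2

lemma pl_norm {F G H : ℝ → ℝ} {l : ℝ} (hl : 0 ≤ l) (hl1 : l ≤ 1)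
    (hF0 : ∀ x, 0 ≤ F x) (hG0 : ∀ x, 0 ≤ G x) (hH0 : ∀ x, 0 ≤ H x)
    (hF : Integrable F) (hG : Integrable G) (hH : Integrable H)
    (hF1 : IsLUB (Set.range F) 1) (hG1 : IsLUB (Set.range G) 1)
    (hC : ∀ t, 0 ≤ t → Set.OrdConnected {x | t < H x})
    (h : ∀ s t, F s ^ l * G t ^ (1 - l) ≤ H (l * s + (1 - l) * t)) :
    l * (∫ x, F x) + (1 - l) * (∫ x, G x) ≤ ∫ x, H x := by
  have hIF : 0 ≤ ∫ x, F x := integral_nonneg hF0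
  have hIG : 0 ≤ ∫ x, G x := integral_nonneg hG0
  have hIH : 0 ≤ ∫ x, H x := integral_nonneg hH0
  rw [← ENNReal.ofReal_le_ofReal_iff hIH, ENNReal.ofReal_add (mul_nonneg hl hIF)
    (mul_nonneg (by linarith) hIG), ENNReal.ofReal_mul hl, ENNReal.ofReal_mul (by linarith),
    ofReal_integral_eq_lintegral_ofReal hF (Filter.Eventually.of_forall hF0),
    ofReal_integral_eq_lintegral_ofReal hG (Filter.Eventually.of_forall hG0),
    ofReal_integral_eq_lintegral_ofReal hH (Filter.Eventually.of_forall hH0),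
    lintegral_eq_lintegral_meas_lt _ (Filter.Eventually.of_forall hF0) hF.aemeasurable,
    lintegral_eq_lintegral_meas_lt _ (Filter.Eventually.of_forall hG0) hG.aemeasurable,
    lintegral_eq_lintegral_meas_lt _ (Filter.Eventually.of_forall hH0) hH.aemeasurable,
    ← lintegral_const_mul' _ _ ENNReal.ofReal_ne_top,
    ← lintegral_const_mul' _ _ ENNReal.ofReal_ne_top]
  refine (le_lintegral_add _ _).trans (setLIntegral_mono' measurableSet_Ioi fun t ht => ?_)
  have ht0 : (0 : ℝ) < t := ht
  rcases lt_or_ge t 1 with ht1 | ht1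
  · apply bm hl hl1 _ _ (hC t ht0.le)
    · intro a ha b hb
      exact (lt_geom_mean_aux ht0.le ha hb hl hl1).trans_le (h a b)
    · obtain ⟨_, ⟨x, rfl⟩, hx⟩ := (lt_isLUB_iff hF1).1 ht1
      exact ⟨x, hx⟩
    · obtain ⟨_, ⟨x, rfl⟩, hx⟩ := (lt_isLUB_iff hG1).1 ht1
      exact ⟨x, hx⟩
  · have e1 : {a | t < F a} = ∅ := by
      ext x; simpa using (hF1.1 ⟨x, rfl⟩).trans ht1
    have e2 : {a | t < G a} = ∅ := by
      ext x; simpa using (hG1.1 ⟨x, rfl⟩).trans ht1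
    simp [e1, e2]

lemma exists_norm {F : ℝ → ℝ} (hF0 : ∀ x, 0 ≤ F x) (hb : ∃ M, ∀ x, F x ≤ M) :
    (∫ x, F x) = 0 ∨ ∃ A, 0 < A ∧ IsLUB (Set.range fun x => F x / A) 1 := by
  obtain ⟨M, hM⟩ := hb
  have hlub : IsLUB (Set.range F) (sSup (Set.range F)) :=
    Real.isLUB_sSup (Set.range_nonempty F) ⟨M, by rintro _ ⟨x, rfl⟩; exact hM x⟩
  set A := sSup (Set.range F)
  have hle : ∀ x, F x ≤ A := fun x => hlub.1 ⟨x, rfl⟩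
  rcases ((hF0 0).trans (hle 0)).eq_or_lt with h0 | h0
  · left
    have : F = fun _ => 0 := funext fun x => le_antisymm (h0 ▸ hle x) (hF0 x)
    rw [this]; simp
  · right
    refine ⟨A, h0, ?_, ?_⟩
    · rintro _ ⟨x, rfl⟩
      exact (div_le_one h0).2 (hle x)
    · intro b hb
      have : A ≤ b * A := hlub.2 (by
        rintro _ ⟨x, rfl⟩
        exact (div_le_iff₀ h0).1 (hb ⟨x, rfl⟩))
      by_contra! hb1
      nlinarith

lemma pl {F G H : ℝ → ℝ} {l : ℝ} (hl : 0 < l) (hl1 : l < 1)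
    (hF0 : ∀ x, 0 ≤ F x) (hG0 : ∀ x, 0 ≤ G x) (hH0 : ∀ x, 0 ≤ H x)
    (hF : Integrable F) (hG : Integrable G) (hH : Integrable H)
    (hFb : ∃ M, ∀ x, F x ≤ M) (hGb : ∃ M, ∀ x, G x ≤ M)
    (hC : ∀ t, 0 ≤ t → Set.OrdConnected {x | t < H x})
    (h : ∀ s t, F s ^ l * G t ^ (1 - l) ≤ H (l * s + (1 - l) * t)) :
    (∫ x, F x) ^ l * (∫ x, G x) ^ (1 - l) ≤ ∫ x, H x := by
  have hIH : 0 ≤ ∫ x, H x := integral_nonneg hH0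
  have hIF : 0 ≤ ∫ x, F x := integral_nonneg hF0
  have hIG : 0 ≤ ∫ x, G x := integral_nonneg hG0
  rcases exists_norm hF0 hFb with h0 | ⟨A, hA, hFA⟩
  · rw [h0, Real.zero_rpow hl.ne']; simpa using hIH
  rcases exists_norm hG0 hGb with h0 | ⟨B, hB, hGB⟩
  · rw [h0, Real.zero_rpow (by linarith)]; simpa using hIH
  have hD : 0 < A ^ l * B ^ (1 - l) := by positivity
  set D := A ^ l * B ^ (1 - l) with hDdef
  have := pl_norm (H := fun x => H x / D) hl.le hl1.le (fun x => div_nonneg (hF0 x) hA.le)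
    (fun x => div_nonneg (hG0 x) hB.le) (fun x => div_nonneg (hH0 x) hD.le)
    (hF.div_const A) (hG.div_const B) (hH.div_const D) hFA hGB ?_ ?_
  · rw [integral_div, integral_div, integral_div] at this
    have h2 := Real.geom_mean_le_arith_mean2_weighted hl.le (by linarith : 0 ≤ 1 - l)
      (div_nonneg hIF hA.le) (div_nonneg hIG hB.le) (by ring)
    have h3 := h2.trans this
    rw [Real.div_rpow hIF hA.le, Real.div_rpow hIG hB.le, div_mul_div_comm, ← hDdef] at h3
    exact (div_le_div_iff_of_pos_right hD).1 h3
  · intro t ht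
    have := hC (t * D) (by positivity)
    simpa only [lt_div_iff₀ hD] using this
  · intro s t
    rw [Real.div_rpow (hF0 _) hA.le, Real.div_rpow (hG0 _) hB.le, div_mul_div_comm, ← hDdef]
    exact (div_le_div_iff_of_pos_right hD).2 (h s t)

/-- **Convolution.** If `f, g : ℝ → [0, ∞)` are log-concave and integrable (with respect
to Lebesgue measure), then their convolution `(f ∗ g)(x) = ∫ f(s) g(x − s) ds`
is log-concave. -/
theorem logConcave_convolution (f g : ℝ → ℝ)
    (hf0 : ∀ x, 0 ≤ f x) (hg0 : ∀ x, 0 ≤ g x)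
    (hf : LogConcave f) (hg : LogConcave g)
    (hfi : Integrable f) (hgi : Integrable g) :
    LogConcave (fun x => ∫ s, f s * g (x - s)) := by
  obtain ⟨M, hM⟩ := hf.bounded hf0 hfi
  obtain ⟨N, hN⟩ := hg.bounded hg0 hgi
  have key : ∀ x y l s t : ℝ, 0 ≤ l → l ≤ 1 →
      (f s * g (x - s)) ^ l * (f t * g (y - t)) ^ (1 - l) ≤
      f (l * s + (1 - l) * t) * g ((l * x + (1 - l) * y) - (l * s + (1 - l) * t)) := by
    intro x y l s t hl hl1
    rw [Real.mul_rpow (hf0 _) (hg0 _), Real.mul_rpow (hf0 _) (hg0 _), mul_mul_mul_comm,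
      show (l * x + (1 - l) * y) - (l * s + (1 - l) * t) = l * (x - s) + (1 - l) * (y - t) by ring]
    exact mul_le_mul (hf s t l hl hl1) (hg _ _ l hl hl1)
      (mul_nonneg (Real.rpow_nonneg (hg0 _) _) (Real.rpow_nonneg (hg0 _) _)) (hf0 _)
  have hint : ∀ x, Integrable (fun s => f s * g (x - s)) := fun x =>
    (hgi.comp_sub_left x).bdd_mul (c := M) hfi.aestronglyMeasurable
      (Filter.Eventually.of_forall fun s => by
        rw [Real.norm_of_nonneg (hf0 s)]; exact hM s)
  have hnn : ∀ x s, 0 ≤ f s * g (x - s) := fun x s => mul_nonneg (hf0 _) (hg0 _)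
  have hbd : ∀ x, ∃ K, ∀ s, f s * g (x - s) ≤ K := fun x =>
    ⟨M * N, fun s => mul_le_mul (hM _) (hN _) (hg0 _) ((hf0 s).trans (hM s))⟩
  have hlc : ∀ x, LogConcave (fun s => f s * g (x - s)) := by
    intro x s t l hl hl1
    have := key x x l s t hl hl1
    rwa [show l * x + (1 - l) * x = x by ring] at this
  intro x y l hl hl1
  rcases hl.eq_or_lt with rfl | hl
  · simp
  rcases hl1.eq_or_lt with rfl | hl1
  · simp
  exact pl hl hl1 (hnn x) (hnn y) (hnn _) (hint x) (hint y) (hint _) (hbd x) (hbd y)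
    (fun t ht => (hlc _).ordConnected ht) (fun s t => key x y l s t hl.le hl1.le)
end

section
/- (Lloyd–Max iteration does not increase distortion) Let f be a probability density on ℝ with finite second moment. Let p_0 = −∞ ≤ p_1 ≤ ⋯ ≤ p_{N−1} ≤ p_N = +∞ be partition points such that every cell has positive mass, let c_0 < ⋯ < c_{N−1} be arbitrary reproduction points, let c*_ℓ = (∫_{p_ℓ}^{p_{ℓ+1}} w f(w) dw)/(∫_{p_ℓ}^{p_{ℓ+1}} f(w) dw) be the cell centroids, and let p* be the midpoint partition of c* (p*_0 = −∞, p*_N = +∞, p*_ℓ = (c*_{ℓ−1} + c*_ℓ)/2). Then D(p*, c*) ≤ D(p, c*) ≤ D(p, c); i.e., one full iteration of the Lloyd–Max algorithm (centroid step followed by nearest-neighbor step) does not increase the distortion. -/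
open MeasureTheory

/-- The cell `[p ℓ, p (ℓ+1))` of a partition of the extended real line
`p : Fin (N+1) → EReal`, viewed as a subset of `ℝ`. -/
def cell (N : ℕ) (p : Fin (N + 1) → EReal) (ℓ : Fin N) : Set ℝ :=
  {w : ℝ | p ℓ.castSucc ≤ (w : EReal) ∧ (w : EReal) < p ℓ.succ}

/-- The probability mass of cell `ℓ`. -/
noncomputable def cellMass (N : ℕ) (f : ℝ → ℝ) (p : Fin (N + 1) → EReal) (ℓ : Fin N) : ℝ :=
  ∫ w in cell N p ℓ, f w

/-- The centroid (conditional mean) of cell `ℓ`. -/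
noncomputable def centroid (N : ℕ) (f : ℝ → ℝ) (p : Fin (N + 1) → EReal) (ℓ : Fin N) : ℝ :=
  (∫ w in cell N p ℓ, w * f w) / cellMass N f p ℓ

/-- The mean squared error distortion of a regular scalar quantizer. -/
noncomputable def distortion (N : ℕ) (f : ℝ → ℝ) (p : Fin (N + 1) → EReal)
    (c : Fin N → ℝ) : ℝ :=
  ∑ ℓ : Fin N, ∫ w in cell N p ℓ, (w - c ℓ) ^ 2 * f w

/-- The midpoint partition associated with reproduction points `c`:
`p*_0 = −∞`, `p*_N = +∞`, and `p*_ℓ = (c_{ℓ−1} + c_ℓ)/2` for `ℓ ∈ {1, …, N−1}`. -/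
noncomputable def midPartition (N : ℕ) (c : Fin N → ℝ) : Fin (N + 1) → EReal :=
  fun ℓ =>
    if h0 : ℓ.val = 0 then ⊥
    else if hN : ℓ.val = N then ⊤
    else (((c ⟨ℓ.val - 1, by omega⟩ + c ⟨ℓ.val, by omega⟩) / 2 : ℝ) : EReal)

theorem aux_cell_measurable (N : ℕ) (p : Fin (N + 1) → EReal) (l : Fin N) :
    MeasurableSet (cell N p l) := by
  unfold cell
  exact (measurableSet_le measurable_const measurable_coe_real_ereal).inter
    (measurableSet_lt measurable_coe_real_ereal measurable_const)

theorem aux_cell_disj (N : ℕ) (p : Fin (N + 1) → EReal) (hp : Monotone p) (w : ℝ)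
    (i j : Fin N) (hi : w ∈ cell N p i) (hj : w ∈ cell N p j) : i = j := by
  have key : ∀ i j : Fin N, w ∈ cell N p i → w ∈ cell N p j → ¬ i < j := by
    intro i j hi hj hij
    have h : p i.succ ≤ p j.castSucc := hp (by
      rw [Fin.le_def]; simp; omega)
    exact absurd (lt_of_lt_of_le hi.2 (h.trans hj.1)) (lt_irrefl _)
  rcases lt_trichotomy i j with h | h | h
  · exact absurd h (key i j hi hj)
  · exact h
  · exact absurd h (key j i hj hi)

theorem aux_cell_exists (N : ℕ) (p : Fin (N + 1) → EReal)
    (hp0 : p 0 = ⊥) (hpN : p (Fin.last N) = ⊤) (w : ℝ) : ∃ k, w ∈ cell N p k := by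
  by_contra hcon
  push Not at hcon
  have : ∀ i : Fin (N + 1), p i ≤ (w : EReal) := by
    intro i
    induction i using Fin.induction with
    | zero => rw [hp0]; exact bot_le
    | succ i ih =>
      by_contra h
      exact hcon i ⟨ih, not_le.mp h⟩
  have h := this (Fin.last N)
  rw [hpN] at h
  exact absurd h (not_le.mpr (EReal.coe_lt_top w))

theorem aux_mid_mono (N : ℕ) (c : Fin N → ℝ) (hc : Monotone c) :
    Monotone (midPartition N c) := by
  intro i j hij
  have hij' : i.val ≤ j.val := hij
  unfold midPartition
  by_cases hi : i.val = 0
  · simp [hi]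
  by_cases hj : j.val = N
  · have hj0 : j.val ≠ 0 := by omega
    rw [dif_neg hj0, dif_pos hj]; exact le_top
  have hi2 : i.val ≠ N := by omega
  have hj0 : j.val ≠ 0 := by omega
  rw [dif_neg hi, dif_neg hi2, dif_neg hj0, dif_neg hj, EReal.coe_le_coe_iff]
  have h1 : c ⟨i.val - 1, by omega⟩ ≤ c ⟨j.val - 1, by omega⟩ := hc (by
    rw [Fin.le_def]; simp; omega)
  have h2 : c ⟨i.val, by omega⟩ ≤ c ⟨j.val, by omega⟩ := hc (by
    rw [Fin.le_def]; simp; omega)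
  linarith

theorem aux_nearest (N : ℕ) (c : Fin N → ℝ) (hc : Monotone c) (w : ℝ) (j k : Fin N)
    (hj : w ∈ cell N (midPartition N c) j) : (w - c j) ^ 2 ≤ (w - c k) ^ 2 := by
  obtain ⟨h1, h2⟩ := hj
  rcases lt_trichotomy j k with h | h | h
  · have hlt : j.val < k.val := h
    have hk := k.isLt
    unfold midPartition at h2
    rw [dif_neg (by simp), dif_neg (by simp; omega), EReal.coe_lt_coe_iff] at h2
    have e1 : c ⟨j.succ.val - 1, by simp⟩ = c j := by congr 1
    have e2 : c ⟨j.succ.val, by simp; omega⟩ ≤ c k := hc (by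
      rw [Fin.le_def]; simp; omega)
    have e3 := hc h.le
    rw [e1] at h2
    nlinarith
  · rw [h]
  · have hlt : k.val < j.val := h
    have hk := j.isLt
    unfold midPartition at h1
    rw [dif_neg (by simp; omega), dif_neg (by simp; omega), EReal.coe_le_coe_iff] at h1
    have e1 : c ⟨j.castSucc.val, by simp⟩ = c j := by congr 1
    have e2 : c k ≤ c ⟨j.castSucc.val - 1, by simp; omega⟩ := hc (by
      rw [Fin.le_def]; simp; omega)
    have e3 := hc h.le
    rw [e1] at h1
    nlinarith

theorem aux_int1 (f : ℝ → ℝ) (hf_meas : Measurable f) (hf0 : ∀ x, 0 ≤ f x)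
    (hf : Integrable f) (hf2 : Integrable (fun w => w ^ 2 * f w)) :
    Integrable (fun w => w * f w) := by
  refine (hf.add hf2).mono' (measurable_id.mul hf_meas).aestronglyMeasurable
    (Filter.Eventually.of_forall fun w => ?_)
  simp only [Pi.add_apply]
  rw [Real.norm_eq_abs, abs_mul, abs_of_nonneg (hf0 w)]
  have : |w| ≤ 1 + w ^ 2 := by
    rw [abs_le]; constructor <;> nlinarith [sq_nonneg (w - 1), sq_nonneg (w + 1)]
  nlinarith [mul_le_mul_of_nonneg_right this (hf0 w)]

theorem aux_int2 (f : ℝ → ℝ) (hf : Integrable f) (h1 : Integrable (fun w => w * f w))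
    (hf2 : Integrable (fun w => w ^ 2 * f w)) (a : ℝ) :
    Integrable (fun w => (w - a) ^ 2 * f w) := by
  have := (hf2.sub (h1.const_mul (2 * a))).add (hf.const_mul (a ^ 2))
  refine this.congr (Filter.Eventually.of_forall fun w => ?_)
  simp only [Pi.add_apply, Pi.sub_apply]
  ring

theorem aux_expand (f : ℝ → ℝ) (hf : Integrable f) (h1 : Integrable (fun w => w * f w))
    (hf2 : Integrable (fun w => w ^ 2 * f w)) (a : ℝ) (s : Set ℝ) :
    ∫ w in s, (w - a) ^ 2 * f w =
      (∫ w in s, w ^ 2 * f w) - 2 * a * (∫ w in s, w * f w) + a ^ 2 * ∫ w in s, f w := by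
  have i0 := hf.integrableOn (s := s)
  have i1 := h1.integrableOn (s := s)
  have i2 := hf2.integrableOn (s := s)
  have i3 : IntegrableOn (fun w => w ^ 2 * f w - 2 * a * (w * f w)) s :=
    i2.sub (i1.const_mul (2 * a))
  rw [← integral_const_mul, ← integral_const_mul, ← integral_sub i2 (i1.const_mul _),
    ← integral_add i3 (i0.const_mul _)]
  congr 1
  ext w
  ring

theorem aux_centroid_mono (N : ℕ) (f : ℝ → ℝ) (hf0 : ∀ x, 0 ≤ f x)
    (hf : Integrable f) (h1 : Integrable (fun w => w * f w))
    (p : Fin (N + 1) → EReal) (hp : Monotone p)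
    (hmass : ∀ l : Fin N, 0 < cellMass N f p l) : Monotone (centroid N f p) := by
  have hne : ∀ l, (cell N p l).Nonempty := by
    intro l
    by_contra h
    rw [Set.not_nonempty_iff_eq_empty] at h
    have := hmass l
    unfold cellMass at this
    rw [h] at this
    simp at this
  intro i j hij
  rcases hij.eq_or_lt with h | h
  · rw [h]
  have hle : p i.succ ≤ p j.castSucc := hp (by
    have : i.val < j.val := h
    rw [Fin.le_def]; simp; omega)
  obtain ⟨u, hu⟩ := hne i
  obtain ⟨v, hv⟩ := hne j
  have htop : p j.castSucc ≠ ⊤ := ne_top_of_le_ne_top (EReal.coe_ne_top v) hv.1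
  have hbot : p j.castSucc ≠ ⊥ := by
    intro hb
    have := lt_of_lt_of_le hu.2 hle
    rw [hb] at this
    exact not_lt_bot this
  obtain ⟨a, ha⟩ : ∃ a : ℝ, (a : EReal) = p j.castSucc := ⟨_, EReal.coe_toReal htop hbot⟩
  have A : centroid N f p i ≤ a := by
    unfold centroid
    rw [div_le_iff₀ (hmass i)]
    unfold cellMass
    rw [← integral_const_mul]
    refine setIntegral_mono_on h1.integrableOn (hf.const_mul a).integrableOn
      (aux_cell_measurable N p i) fun w hw => ?_
    have : (w : EReal) < a := by rw [ha]; exact lt_of_lt_of_le hw.2 hle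
    exact mul_le_mul_of_nonneg_right (EReal.coe_lt_coe_iff.mp this).le (hf0 w)
  have B : a ≤ centroid N f p j := by
    unfold centroid
    rw [le_div_iff₀ (hmass j)]
    unfold cellMass
    rw [← integral_const_mul]
    refine setIntegral_mono_on (hf.const_mul a).integrableOn h1.integrableOn
      (aux_cell_measurable N p j) fun w hw => ?_
    have : (a : EReal) ≤ w := by rw [ha]; exact hw.1
    exact mul_le_mul_of_nonneg_right (EReal.coe_le_coe_iff.mp this) (hf0 w)
  exact A.trans B

theorem aux_dist_eq (N : ℕ) (f : ℝ → ℝ) (q : Fin (N + 1) → EReal) (c : Fin N → ℝ)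
    (hi : ∀ a, Integrable (fun w => (w - a) ^ 2 * f w)) :
    distortion N f q c =
      ∫ w, ∑ l, (cell N q l).indicator (fun w => (w - c l) ^ 2 * f w) w := by
  unfold distortion
  rw [integral_finsetSum _ fun l _ => (hi (c l)).indicator (aux_cell_measurable N q l)]
  refine Finset.sum_congr rfl fun l _ => ?_
  rw [integral_indicator (aux_cell_measurable N q l)]

/-- **Lloyd–Max iteration does not increase distortion.** Let `f` be a probability
density on `ℝ` with finite second moment. Let `p_0 = −∞ ≤ p_1 ≤ ⋯ ≤ p_N = +∞` be a
partition all of whose cells have positive mass, let `c_0 < ⋯ < c_{N−1}` be arbitrary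
reproduction points, let `c*` be the cell centroids, and let `p*` be the midpoint
partition of `c*`. Then `D(p*, c*) ≤ D(p, c*) ≤ D(p, c)`: one full Lloyd–Max iteration
(centroid step followed by nearest-neighbor step) does not increase the distortion. -/
theorem lloydMax_iteration_not_increase (N : ℕ) (hN : 0 < N) (f : ℝ → ℝ)
    (hf_meas : Measurable f) (hf0 : ∀ x, 0 ≤ f x) (hf1 : ∫ w, f w = 1)
    (hf2 : Integrable (fun w => w ^ 2 * f w))
    (p : Fin (N + 1) → EReal) (hp : Monotone p)
    (hp0 : p 0 = ⊥) (hpN : p (Fin.last N) = ⊤)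
    (hmass : ∀ ℓ : Fin N, 0 < cellMass N f p ℓ)
    (c : Fin N → ℝ) (hc : StrictMono c) :
    distortion N f (midPartition N (centroid N f p)) (centroid N f p) ≤
        distortion N f p (centroid N f p) ∧
      distortion N f p (centroid N f p) ≤ distortion N f p c := by
  have hf : Integrable f := by
    by_contra h
    rw [integral_undef h] at hf1
    exact zero_ne_one hf1
  have h1 := aux_int1 f hf_meas hf0 hf hf2
  have hi := aux_int2 f hf h1 hf2
  have hm := aux_centroid_mono N f hf0 hf h1 p hp hmass
  constructor
  · rw [aux_dist_eq N f _ _ hi, aux_dist_eq N f _ _ hi]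
    set b := centroid N f p
    refine integral_mono
      (integrable_finsetSum _ fun l _ => (hi (b l)).indicator (aux_cell_measurable N _ l))
      (integrable_finsetSum _ fun l _ => (hi (b l)).indicator (aux_cell_measurable N _ l))
      fun w => ?_
    have nn : ∀ l, 0 ≤ (cell N p l).indicator (fun w => (w - b l) ^ 2 * f w) w := fun l =>
      Set.indicator_nonneg (fun x _ => mul_nonneg (sq_nonneg _) (hf0 x)) w
    by_cases hj : ∃ j, w ∈ cell N (midPartition N b) j
    · obtain ⟨j, hj⟩ := hj
      obtain ⟨k, hk⟩ := aux_cell_exists N p hp0 hpN w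
      calc _ = (w - b j) ^ 2 * f w := by
            rw [Finset.sum_eq_single j, Set.indicator_of_mem hj]
            · intro l _ hl
              exact Set.indicator_of_notMem
                (fun h => hl (aux_cell_disj N _ (aux_mid_mono N b hm) w l j h hj)) _
            · intro h; exact absurd (Finset.mem_univ j) h
        _ ≤ (w - b k) ^ 2 * f w :=
            mul_le_mul_of_nonneg_right (aux_nearest N b hm w j k hj) (hf0 w)
        _ = (cell N p k).indicator (fun w => (w - b k) ^ 2 * f w) w :=
            (Set.indicator_of_mem hk (fun w => (w - b k) ^ 2 * f w)).symm
        _ ≤ _ := Finset.single_le_sum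
            (f := fun l => (cell N p l).indicator (fun w => (w - b l) ^ 2 * f w) w)
            (fun l _ => nn l) (Finset.mem_univ k)
    · push Not at hj
      have : ∑ l, (cell N (midPartition N b) l).indicator
          (fun w => (w - b l) ^ 2 * f w) w = 0 :=
        Finset.sum_eq_zero fun l _ => Set.indicator_of_notMem (hj l) _
      simp only [this]
      exact Finset.sum_nonneg fun l _ => nn l
  · unfold distortion
    refine Finset.sum_le_sum fun l _ => ?_
    rw [aux_expand f hf h1 hf2, aux_expand f hf h1 hf2]
    have hpos := hmass l
    have e : ∫ w in cell N p l, w * f w = centroid N f p l * cellMass N f p l := by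
      unfold centroid
      rw [div_mul_cancel₀ _ hpos.ne']
    rw [e]
    change _ - _ + _ * cellMass N f p l ≤ _ - _ + _ * cellMass N f p l
    nlinarith [mul_nonneg (sq_nonneg (c l - centroid N f p l)) hpos.le]
end
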